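/- In the ring ℤ[[q, y]] of formal power series in two variables, ∏_{n≥1} (1 − q^n y)^{−1} = ∑ over all descending sequences r of q^{∑_{t≥1} (r^{(t)})²} · y^{|r|} · ∏_{j≥1} (q;q)_{r^{(j)} − r^{(j+1)}}^{−1}. -/

import Mathlib

open MvPowerSeries

/-- The product topology (coefficientwise convergence) on multivariate formal power series. -/
noncomputable instance (σ R : Type*) [TopologicalSpace R] :
    TopologicalSpace (MvPowerSeries σ R) :=
  inferInstanceAs (TopologicalSpace ((σ →₀ ℕ) → R))

/-- `r : ℕ → ℕ` is a descending sequence (indexed so that `r t = r^{(t+1)}`):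
nonincreasing and eventually zero. -/
def IsDescending (r : ℕ → ℕ) : Prop :=
  Antitone r ∧ ∃ N, ∀ t ≥ N, r t = 0

open Finset in
/-- The finite Durfee-rectangle identity, in terms of `E n = 1 / (q;q)_n`. -/
theorem sum_antidiagonal_durfee {R : Type*} [CommRing R] {q : R} {E : ℕ → R} (hE0 : E 0 = 1)
    (hE : ∀ n, E n = (1 - q ^ (n + 1)) * E (n + 1)) (hq : ∀ n, IsUnit (1 - q ^ (n + 1)))
    (n : ℕ) (y : R) :
    ∑ p ∈ antidiagonal n, q ^ p.1 ^ 2 * y ^ p.1 * (E p.1 * E p.2) *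
      ∏ i ∈ range p.2, (1 - q ^ (p.1 + i + 1) * y) = E n := by
  induction n generalizing y with
  | zero => simp [hE0]
  | succ n ih =>
    refine (hq n).mul_left_cancel ?_
    rw [← hE, ← ih (q * y), mul_sum]
    have split : ∀ p ∈ antidiagonal (n + 1),
        (1 - q ^ (n + 1)) * (q ^ p.1 ^ 2 * y ^ p.1 * (E p.1 * E p.2) *
          ∏ i ∈ range p.2, (1 - q ^ (p.1 + i + 1) * y)) =
        q ^ p.1 ^ 2 * y ^ p.1 * (q ^ p.1 * E p.1 * ((1 - q ^ p.2) * E p.2)) *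
          ∏ i ∈ range p.2, (1 - q ^ (p.1 + i + 1) * y) +
        q ^ p.1 ^ 2 * y ^ p.1 * ((1 - q ^ p.1) * E p.1 * E p.2) *
          ∏ i ∈ range p.2, (1 - q ^ (p.1 + i + 1) * y) := by
      intro p hp
      rw [← mem_antidiagonal.mp hp, pow_add]
      ring
    rw [sum_congr rfl split, sum_add_distrib, Nat.sum_antidiagonal_succ',
      Nat.sum_antidiagonal_succ]
    simp only [pow_zero, sub_self, zero_mul, mul_zero, zero_add, ← hE]
    rw [← sum_add_distrib]
    refine sum_congr rfl fun p _ => ?_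
    have hprod : ∏ i ∈ range p.2, (1 - q ^ (p.1 + 1 + i + 1) * y) =
        ∏ i ∈ range p.2, (1 - q ^ (p.1 + i + 1) * (q * y)) :=
      prod_congr rfl fun i _ => by ring
    have hprod' : ∏ i ∈ range p.2, (1 - q ^ (p.1 + (i + 1) + 1) * y) =
        ∏ i ∈ range p.2, (1 - q ^ (p.1 + i + 1) * (q * y)) :=
      prod_congr rfl fun i _ => by ring
    rw [prod_range_succ', hprod, hprod']
    ring

theorem dvd_prod_sub_one {R ι : Type*} [CommRing R] {a : R} {s : Finset ι} {f : ι → R}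
    (h : ∀ i ∈ s, a ∣ f i - 1) : a ∣ ∏ i ∈ s, f i - 1 := by
  refine Finset.prod_induction f (fun x => a ∣ x - 1) (fun x z hx hz => ?_) (by simp) h
  have : x * z - 1 = (x - 1) * z + (z - 1) := by ring
  rw [this]
  exact dvd_add (hx.mul_right z) hz

@[to_additive]
theorem finprod_nat_succ {M : Type*} [CommMonoid M] {f : ℕ → M} {N : ℕ}
    (hf : ∀ n ≥ N, f n = 1) : ∏ᶠ n, f n = f 0 * ∏ᶠ n, f (n + 1) := by
  rw [finprod_eq_prod_of_mulSupport_subset f (s := Finset.range (N + 1)),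
    finprod_eq_prod_of_mulSupport_subset (fun n => f (n + 1)) (s := Finset.range N),
    Finset.prod_range_succ', mul_comm]
  all_goals
    intro n hn
    simp only [Finset.coe_range, Set.mem_Iio]
    by_contra! h
    exact hn (hf _ (by omega))

namespace MvPowerSeries

theorem coeff_mul_of_X_pow_dvd_sub_one {σ R : Type*} [CommRing R] {s : σ} {N : ℕ}
    {g : MvPowerSeries σ R} (hg : X s ^ N ∣ g - 1) {m : σ →₀ ℕ} (hm : m s < N)
    (h : MvPowerSeries σ R) : coeff m (g * h) = coeff m h := by
  have := X_pow_dvd_iff.mp (hg.mul_right h) m hm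
  rwa [sub_mul, one_mul, map_sub, sub_eq_zero] at this

instance instT3SpaceInt {σ : Type*} : T3Space (MvPowerSeries σ ℤ) :=
  inferInstanceAs (T3Space ((σ →₀ ℕ) → ℤ))

instance instIsTopologicalRingInt {σ : Type*} : IsTopologicalRing (MvPowerSeries σ ℤ) :=
  WithPiTopology.instIsTopologicalRing σ ℤ

theorem hasSum_iff_coeff {σ ι : Type*} {f : ι → MvPowerSeries σ ℤ} {a : MvPowerSeries σ ℤ} :
    HasSum f a ↔ ∀ m, HasSum (fun i => coeff m (f i)) (coeff m a) :=
  WithPiTopology.hasSum_iff_hasSum_coeff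

theorem summable_of_X_pow_dvd {σ ι : Type*} {f : ι → MvPowerSeries σ ℤ} (s : σ) (w : ι → ℕ)
    (hw : ∀ d, {i | w i ≤ d}.Finite) (hf : ∀ i, X s ^ w i ∣ f i) : Summable f := by
  refine WithPiTopology.summable_iff_summable_coeff.mpr fun m => ?_
  refine summable_of_ne_finset_zero (s := (hw (m s)).toFinset) fun i hi => ?_
  exact X_pow_dvd_iff.mp (hf i) m (by simpa using hi)

theorem hasProd_of_eventually_coeff {σ ι : Type*} {f : ι → MvPowerSeries σ ℤ}
    {a : MvPowerSeries σ ℤ}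
    (h : ∀ m, ∀ᶠ s : Finset ι in Filter.atTop, coeff m (∏ i ∈ s, f i) = coeff m a) :
    HasProd f a := by
  refine (WithPiTopology.tendsto_iff_coeff_tendsto _ _ _).mpr fun m => ?_
  refine tendsto_nhds_of_eventually_eq ?_
  simpa using h m

end MvPowerSeries

namespace IsDescending

theorem tail {r : ℕ → ℕ} (hr : IsDescending r) : IsDescending fun t => r (t + 1) :=
  ⟨fun _ _ h => hr.1 (by omega), hr.2.imp fun _ hN t ht => hN _ (by omega)⟩

theorem cons {r : ℕ → ℕ} (hr : IsDescending r) {s : ℕ} (hs : r 0 ≤ s) :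
    IsDescending fun t => Nat.casesOn t s r := by
  obtain ⟨hanti, N, hN⟩ := hr
  refine ⟨antitone_nat_of_succ_le fun t => ?_, N + 1, fun t ht => ?_⟩
  · cases t with
    | zero => exact hs
    | succ t => exact hanti t.le_succ
  · cases t with
    | zero => omega
    | succ t => exact hN t (by omega)

/-- Removing the first entry is a bijection from descending sequences starting at `s` to
descending sequences bounded by `s`. -/
def tailEquiv (s : ℕ) :
    (fun r : {r : ℕ → ℕ // IsDescending r} => r.1 0) ⁻¹' {s} ≃
      (fun r : {r : ℕ → ℕ // IsDescending r} => r.1 0) ⁻¹' Set.Iic s where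
  toFun r := ⟨⟨fun t => r.1.1 (t + 1), r.1.2.tail⟩,
    Set.mem_Iic.mpr ((r.1.2.1 (Nat.zero_le 1)).trans_eq r.2)⟩
  invFun r := ⟨⟨fun t => Nat.casesOn t s r.1.1, r.1.2.cons r.2⟩, by simp⟩
  left_inv r := by
    ext t
    cases t with
    | zero => exact r.2.symm
    | succ t => rfl
  right_inv r := rfl

theorem sum_range_le_finsum {r : ℕ → ℕ} (hr : IsDescending r) (n : ℕ) :
    ∑ t ∈ Finset.range n, r t ≤ ∑ᶠ t, r t := by
  obtain ⟨-, N, hN⟩ := hr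
  rw [finsum_eq_sum_of_support_subset r (s := Finset.range (max n N))]
  · exact Finset.sum_le_sum_of_subset (by simp)
  · intro t ht
    simp only [Finset.coe_range, Set.mem_Iio]
    by_contra! h
    exact ht (hN t (by omega))

theorem le_finsum {r : ℕ → ℕ} (hr : IsDescending r) (t : ℕ) : r t ≤ ∑ᶠ t, r t :=
  (Finset.single_le_sum (fun _ _ => Nat.zero_le _) (Finset.self_mem_range_succ t)).trans
    (hr.sum_range_le_finsum (t + 1))

theorem eq_zero_of_finsum_le {r : ℕ → ℕ} (hr : IsDescending r) {t : ℕ} (ht : ∑ᶠ t, r t ≤ t) :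
    r t = 0 := by
  by_contra h
  have h1 : ∑ i ∈ Finset.range (t + 1), 1 ≤ ∑ i ∈ Finset.range (t + 1), r i :=
    Finset.sum_le_sum fun i hi =>
      (Nat.one_le_iff_ne_zero.mpr h).trans (hr.1 (by simpa [Nat.lt_succ_iff] using hi))
  have h2 := hr.sum_range_le_finsum (t + 1)
  simp only [Finset.sum_const, Finset.card_range, smul_eq_mul, mul_one] at h1
  omega

theorem finite_finsum_le (d : ℕ) :
    {r : {r : ℕ → ℕ // IsDescending r} | ∑ᶠ t, r.1 t ≤ d}.Finite := by
  refine Set.Finite.of_injOn (f := fun r (i : Fin d) => r.1 i)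
    (t := {g : Fin d → ℕ | ∀ i, g i ∈ Set.Iic d}) (fun r hr i => (r.2.le_finsum i).trans hr) ?_
    (Set.Finite.pi' fun _ => Set.finite_Iic d)
  intro r hr r' hr' h
  ext t
  by_cases ht : t < d
  · exact congrFun h ⟨t, ht⟩
  · rw [r.2.eq_zero_of_finsum_le (hr.trans (not_lt.mp ht)),
      r'.2.eq_zero_of_finsum_le (hr'.trans (not_lt.mp ht))]

end IsDescending

namespace DurfeeDissection

local notation "q" => (X 0 : MvPowerSeries (Fin 2) ℤ)
local notation "y" => (X 1 : MvPowerSeries (Fin 2) ℤ)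

/-- `1 / (q;q)_n` in `ℤ[[q, y]]`. -/
noncomputable def qFactorialInv (n : ℕ) : MvPowerSeries (Fin 2) ℤ :=
  Ring.inverse (∏ u ∈ Finset.range n, (1 - q ^ (u + 1)))

/-- `1 / (qy;q)_n` in `ℤ[[q, y]]`. -/
noncomputable def shiftedInv (n : ℕ) : MvPowerSeries (Fin 2) ℤ :=
  ∏ i ∈ Finset.range n, Ring.inverse (1 - q ^ (i + 1) * y)

/-- The summand attached to a sequence `r`. -/
noncomputable def term (r : ℕ → ℕ) : MvPowerSeries (Fin 2) ℤ :=
  q ^ (∑ᶠ t : ℕ, (r t) ^ 2) * y ^ (∑ᶠ t : ℕ, r t) * ∏ᶠ j : ℕ, qFactorialInv (r j - r (j + 1))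

/-- The sum of the terms of the descending sequences with first entry `s`. -/
noncomputable def fiberSum (s : ℕ) : MvPowerSeries (Fin 2) ℤ :=
  ∑' r : (fun r : {r : ℕ → ℕ // IsDescending r} => r.1 0) ⁻¹' {s}, term r.1.1

theorem isUnit_one_sub_q_pow (n : ℕ) : IsUnit (1 - q ^ (n + 1)) := by
  simp [isUnit_iff_constantCoeff]

theorem isUnit_one_sub_q_pow_mul_y (n : ℕ) : IsUnit (1 - q ^ (n + 1) * y) := by
  simp [isUnit_iff_constantCoeff]

theorem isUnit_qFactorial (n : ℕ) : IsUnit (∏ u ∈ Finset.range n, (1 - q ^ (u + 1))) := by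
  simp [isUnit_iff_constantCoeff]

theorem qFactorialInv_zero : qFactorialInv 0 = 1 := by
  simp [qFactorialInv]

theorem prod_mul_qFactorialInv (t k : ℕ) :
    (∏ u ∈ Finset.range (t + k), (1 - q ^ (u + 1))) * qFactorialInv t =
      ∏ i ∈ Finset.range k, (1 - q ^ (t + i + 1)) := by
  rw [Finset.prod_range_add, mul_right_comm, qFactorialInv,
    Ring.mul_inverse_cancel _ (isUnit_qFactorial t), one_mul]

theorem qFactorialInv_eq (n : ℕ) :
    qFactorialInv n = (1 - q ^ (n + 1)) * qFactorialInv (n + 1) := by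
  refine (isUnit_qFactorial n).mul_left_cancel ?_
  have h0 := prod_mul_qFactorialInv n 0
  have h1 := prod_mul_qFactorialInv (n + 1) 0
  simp only [add_zero, Finset.range_zero, Finset.prod_empty] at h0 h1
  rw [h0, ← mul_assoc, ← Finset.prod_range_succ, h1]

theorem prod_mul_shiftedInv (s t : ℕ) :
    (∏ i ∈ Finset.range t, (1 - q ^ (s + i + 1) * y)) * shiftedInv (s + t) = shiftedInv s := by
  rw [shiftedInv, Finset.prod_range_add, mul_left_comm, ← Finset.prod_mul_distrib,
    Finset.prod_eq_one fun i _ => Ring.mul_inverse_cancel _ (isUnit_one_sub_q_pow_mul_y _),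
    mul_one, shiftedInv]

open Finset in
theorem sum_antidiagonal_shiftedInv (n : ℕ) :
    ∑ p ∈ antidiagonal n,
      qFactorialInv p.2 * (q ^ p.1 ^ 2 * y ^ p.1 * (qFactorialInv p.1 * shiftedInv p.1)) =
      qFactorialInv n * shiftedInv n := by
  rw [← sum_antidiagonal_durfee qFactorialInv_zero qFactorialInv_eq isUnit_one_sub_q_pow n y,
    sum_mul]
  refine sum_congr rfl fun p hp => ?_
  rw [← mem_antidiagonal.mp hp, ← prod_mul_shiftedInv p.1 p.2]
  ring

theorem term_eq {r : ℕ → ℕ} (hr : IsDescending r) :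
    term r = q ^ r 0 ^ 2 * y ^ r 0 * (qFactorialInv (r 0 - r 1) * term fun t => r (t + 1)) := by
  obtain ⟨-, N, hN⟩ := hr
  rw [term, finsum_nat_succ (N := N) (f := fun t => r t ^ 2) fun n hn => by simp [hN n hn],
    finsum_nat_succ hN, finprod_nat_succ (N := N) fun n hn => by
      simp [hN n hn, qFactorialInv_zero], term]
  ring

theorem y_pow_finsum_dvd_term (r : ℕ → ℕ) : y ^ (∑ᶠ t, r t) ∣ term r :=
  (dvd_mul_left _ _).mul_right _

theorem summable_mul_term {ι : Type*} {e : ι → {r : ℕ → ℕ // IsDescending r}}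
    (he : Function.Injective e) (g : ι → MvPowerSeries (Fin 2) ℤ) :
    Summable fun i => g i * term (e i).1 :=
  summable_of_X_pow_dvd 1 (fun i => ∑ᶠ t, (e i).1 t)
    (fun d => (IsDescending.finite_finsum_le d).preimage he.injOn)
    fun i => (y_pow_finsum_dvd_term (e i).1).mul_left _

theorem summable_term {ι : Type*} {e : ι → {r : ℕ → ℕ // IsDescending r}}
    (he : Function.Injective e) : Summable fun i => term (e i).1 := by
  simpa using summable_mul_term he 1

theorem hasSum_fiberSum :
    HasSum fiberSum (∑' r : {r : ℕ → ℕ // IsDescending r}, term r.1) :=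
  (((Equiv.sigmaFiberEquiv fun r : {r : ℕ → ℕ // IsDescending r} => r.1 0).hasSum_iff).mpr
    (summable_term Function.injective_id).hasSum).sigma
    fun _ => (summable_term Subtype.val_injective).hasSum

theorem fiberSum_zero : fiberSum 0 = 1 := by
  have hzero : IsDescending fun _ => 0 := ⟨antitone_const, 0, fun _ _ => rfl⟩
  rw [fiberSum, tsum_eq_single ⟨⟨_, hzero⟩, rfl⟩]
  · simp [term, qFactorialInv_zero]
  · rintro ⟨r, hr⟩ h
    refine absurd ?_ h
    ext t
    exact Nat.le_zero.mp ((r.2.1 (Nat.zero_le t)).trans_eq hr)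

open Finset in
theorem fiberSum_eq_sum_antidiagonal (s : ℕ) :
    fiberSum s = q ^ s ^ 2 * y ^ s *
      ∑ p ∈ antidiagonal s, qFactorialInv p.2 * fiberSum p.1 := by
  have h (r : (fun r : {r : ℕ → ℕ // IsDescending r} => r.1 0) ⁻¹' {s}) : term r.1.1 =
      q ^ s ^ 2 * y ^ s * (qFactorialInv (s - (IsDescending.tailEquiv s r).1.1 0) *
        term (IsDescending.tailEquiv s r).1.1) := by
    rw [term_eq r.1.2, show r.1.1 0 = s from r.2]
    rfl
  have hind (r : {r : ℕ → ℕ // IsDescending r}) :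
      Set.indicator ((fun r => r.1 0) ⁻¹' Set.Iic s)
          (fun r => qFactorialInv (s - r.1 0) * term r.1) r =
        ∑ p ∈ antidiagonal s, qFactorialInv p.2 *
          Set.indicator ((fun r => r.1 0) ⁻¹' {p.1}) (fun r => term r.1) r := by
    classical
    rw [Nat.sum_antidiagonal_eq_sum_range_succ (fun i j => qFactorialInv j *
      Set.indicator ((fun r : {r : ℕ → ℕ // IsDescending r} => r.1 0) ⁻¹' {i})
        (fun r => term r.1) r)]
    simp only [Set.indicator_apply, Set.mem_preimage, Set.mem_singleton_iff, Set.mem_Iic,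
      mul_ite, mul_zero, sum_ite_eq, mem_range, Nat.lt_succ_iff]
  have hsum (k : ℕ) : Summable (Set.indicator
      ((fun r : {r : ℕ → ℕ // IsDescending r} => r.1 0) ⁻¹' {k}) fun r => term r.1) :=
    summable_subtype_iff_indicator.mp (summable_term Subtype.val_injective)
  have hterm (p : ℕ × ℕ) : Summable fun r => qFactorialInv p.2 *
      Set.indicator ((fun r : {r : ℕ → ℕ // IsDescending r} => r.1 0) ⁻¹' {p.1})
        (fun r => term r.1) r := (hsum p.1).mul_left _
  have hle := summable_mul_term (Subtype.val_injective
    (p := (· ∈ (fun r : {r : ℕ → ℕ // IsDescending r} => r.1 0) ⁻¹' Set.Iic s)))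
    fun r => qFactorialInv (s - r.1.1 0)
  rw [fiberSum, tsum_congr h, (IsDescending.tailEquiv s).tsum_eq
    (fun r => q ^ s ^ 2 * y ^ s * (qFactorialInv (s - r.1.1 0) * term r.1.1)),
    hle.tsum_mul_left,
    tsum_subtype ((fun r : {r : ℕ → ℕ // IsDescending r} => r.1 0) ⁻¹' Set.Iic s)
      (fun r => qFactorialInv (s - r.1 0) * term r.1),
    tsum_congr hind, Summable.tsum_finsetSum fun p _ => hterm p]
  refine congrArg _ (sum_congr rfl fun p _ => ?_)
  rw [(hsum p.1).tsum_mul_left, fiberSum, tsum_subtype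
    ((fun r : {r : ℕ → ℕ // IsDescending r} => r.1 0) ⁻¹' {p.1}) (fun r => term r.1)]

open Finset in
theorem fiberSum_eq (s : ℕ) :
    fiberSum s = q ^ s ^ 2 * y ^ s * (qFactorialInv s * shiftedInv s) := by
  induction s using Nat.strong_induction_on with
  | _ s ih =>
    cases s with
    | zero => simp [fiberSum_zero, qFactorialInv_zero, shiftedInv]
    | succ s =>
      have hS := fiberSum_eq_sum_antidiagonal (s + 1)
      have hA := sum_antidiagonal_shiftedInv (s + 1)
      rw [Nat.sum_antidiagonal_succ', qFactorialInv_zero, one_mul] at hS hA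
      have hlow : ∀ p ∈ antidiagonal s, qFactorialInv (p.2 + 1) * fiberSum p.1 =
          qFactorialInv (p.2 + 1) *
            (q ^ p.1 ^ 2 * y ^ p.1 * (qFactorialInv p.1 * shiftedInv p.1)) := fun p hp => by
        rw [ih p.1 (Nat.lt_succ_of_le (Nat.le.intro (mem_antidiagonal.mp hp)))]
      rw [sum_congr rfl hlow] at hS
      have hu : IsUnit (1 - q ^ (s + 1) ^ 2 * y ^ (s + 1)) := by
        simp [isUnit_iff_constantCoeff]
      refine hu.mul_left_cancel ?_
      linear_combination hS + q ^ (s + 1) ^ 2 * y ^ (s + 1) * hA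

open Finset in
theorem coeff_shiftedInv {N : ℕ} {m : Fin 2 →₀ ℕ} (hN : m 0 + m 1 < N) :
    coeff m (shiftedInv N) =
      coeff m (∑' r : {r : ℕ → ℕ // IsDescending r}, term r.1) := by
  have hlarge (k : ℕ) (hk : m 1 < k) (g : MvPowerSeries (Fin 2) ℤ) :
      coeff m (g * fiberSum k) = 0 :=
    X_pow_dvd_iff.mp (by
      rw [fiberSum_eq]
      exact ((dvd_mul_left _ _).mul_right _).mul_left _) m hk
  have hT : coeff m (∑' r : {r : ℕ → ℕ // IsDescending r}, term r.1) =
      ∑ k ∈ range (N + 1), coeff m (fiberSum k) := by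
    refine (hasSum_iff_coeff.mp hasSum_fiberSum m).unique
      (hasSum_sum_of_ne_finset_zero fun k hk => ?_)
    rw [← one_mul (fiberSum k)]
    exact hlarge k (by simp at hk; omega) 1
  have hV : shiftedInv N =
      (∏ u ∈ range N, (1 - q ^ (u + 1))) * (qFactorialInv N * shiftedInv N) := by
    rw [← mul_assoc, show _ * qFactorialInv N = 1 by simpa using prod_mul_qFactorialInv N 0,
      one_mul]
  rw [hT, hV, ← sum_antidiagonal_shiftedInv, mul_sum, map_sum,
    ← Nat.sum_antidiagonal_eq_sum_range_succ (fun k _ => coeff m (fiberSum k))]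
  refine sum_congr rfl fun p hp => ?_
  rw [← fiberSum_eq, ← mul_assoc]
  by_cases hk : m 1 < p.1
  · rw [hlarge _ hk, ← one_mul (fiberSum p.1), hlarge _ hk]
  · have hpN := mem_antidiagonal.mp hp
    rw [← hpN, add_comm p.1, prod_mul_qFactorialInv]
    refine coeff_mul_of_X_pow_dvd_sub_one (s := 0) (N := p.2) (dvd_prod_sub_one fun i _ => ?_)
      (by omega) _
    rw [sub_sub_cancel_left, dvd_neg]
    exact pow_dvd_pow _ (by omega)

open Finset in
theorem hasProd_inverse_one_sub :
    HasProd (fun n : ℕ => Ring.inverse (1 - q ^ (n + 1) * y))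
      (∑' r : {r : ℕ → ℕ // IsDescending r}, term r.1) := by
  refine hasProd_of_eventually_coeff fun m => ?_
  filter_upwards [Filter.eventually_ge_atTop (range (m 0 + m 1 + 1))] with s hs
  rw [← coeff_shiftedInv (Nat.lt_succ_self _), ← prod_sdiff hs]
  refine coeff_mul_of_X_pow_dvd_sub_one (s := 0) (N := m 0 + m 1 + 1)
    (dvd_prod_sub_one fun n hn => ?_) (by omega) _
  have h := Ring.inverse_mul_cancel _ (isUnit_one_sub_q_pow_mul_y n)
  have hn' : m 0 + m 1 + 1 ≤ n + 1 := by
    simp only [mem_sdiff, mem_range] at hn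
    omega
  rw [show Ring.inverse (1 - q ^ (n + 1) * y) - 1 =
    q ^ (n + 1) * (y * Ring.inverse (1 - q ^ (n + 1) * y)) by linear_combination h]
  exact (pow_dvd_pow _ hn').mul_right _

end DurfeeDissection

/-- In `ℤ[[q, y]]` (with `q = X 0`, `y = X 1` in
`MvPowerSeries (Fin 2) ℤ`):
`∏_{n ≥ 1} (1 - qⁿ y)⁻¹
  = ∑_{r descending} q^{∑_{t≥1} (r^{(t)})²} y^{|r|} ∏_{j ≥ 1} (q;q)_{r^{(j)}-r^{(j+1)}}⁻¹`. -/
theorem stmt_4 :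
    (∏' n : ℕ, Ring.inverse
        (1 - (X 0 : MvPowerSeries (Fin 2) ℤ) ^ (n + 1) * (X 1 : MvPowerSeries (Fin 2) ℤ)))
      = ∑' r : {r : ℕ → ℕ // IsDescending r},
          (X 0 : MvPowerSeries (Fin 2) ℤ) ^ (∑ᶠ t : ℕ, (r.1 t) ^ 2)
            * (X 1 : MvPowerSeries (Fin 2) ℤ) ^ (∑ᶠ t : ℕ, r.1 t)
            * ∏ᶠ j : ℕ,
                Ring.inverse (∏ u ∈ Finset.range (r.1 j - r.1 (j + 1)),
                  (1 - (X 0 : MvPowerSeries (Fin 2) ℤ) ^ (u + 1))) := by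
  exact DurfeeDissection.hasProd_inverse_one_sub.tprod_eq
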